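/- The additive cut rule is admissible in G4CK: if ⊢_G4CK Γ ⇒ φ and ⊢_G4CK Γ,φ ⇒ δ then ⊢_G4CK Γ ⇒ δ. -/

import Mathlib

/-- Formulas of the modal language: φ ::= p | ⊥ | φ∧φ | φ∨φ | φ→φ | □φ | ◇φ. -/
inductive Form : Type
  | var : ℕ → Form
  | bot : Form
  | and : Form → Form → Form
  | or  : Form → Form → Form
  | imp : Form → Form → Form
  | box : Form → Form
  | dia : Form → Form
  deriving DecidableEq

/-- Helper for □⁻¹: remove an outer box. -/
def unboxF : Form → Option Form
  | Form.box φ => some φ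
  | _ => none

/-- □⁻¹Γ := {φ | □φ ∈ Γ}, as a multiset operation. -/
def boxInv (Γ : Multiset Form) : Multiset Form := Γ.filterMap unboxF

/-- ◇⁻¹Δ for a succedent Δ with at most one formula (modelled by `Option`). -/
def diaInv : Option Form → Option Form
  | some (Form.dia φ) => some φ
  | _ => none

/-- Provability in the sequent calculus G4CK: sequents Γ ⇒ δ with a
multiset antecedent and a single-formula succedent. -/
inductive G4CK : Multiset Form → Form → Prop
  | botL (Γ δ) : G4CK (Form.bot ::ₘ Γ) δ
  | idP (Γ n) : G4CK (Form.var n ::ₘ Γ) (Form.var n)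
  | andL (Γ φ ψ δ) : G4CK (φ ::ₘ ψ ::ₘ Γ) δ → G4CK (Form.and φ ψ ::ₘ Γ) δ
  | andR (Γ φ ψ) : G4CK Γ φ → G4CK Γ ψ → G4CK Γ (Form.and φ ψ)
  | orL (Γ φ ψ δ) : G4CK (φ ::ₘ Γ) δ → G4CK (ψ ::ₘ Γ) δ → G4CK (Form.or φ ψ ::ₘ Γ) δ
  | orR1 (Γ φ ψ) : G4CK Γ φ → G4CK Γ (Form.or φ ψ)
  | orR2 (Γ φ ψ) : G4CK Γ ψ → G4CK Γ (Form.or φ ψ)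
  | impR (Γ φ ψ) : G4CK (φ ::ₘ Γ) ψ → G4CK Γ (Form.imp φ ψ)
  | andImpL (Γ φ ψ χ δ) :
      G4CK (Form.imp φ (Form.imp ψ χ) ::ₘ Γ) δ →
      G4CK (Form.imp (Form.and φ ψ) χ ::ₘ Γ) δ
  | orImpL (Γ φ ψ χ δ) :
      G4CK (Form.imp φ χ ::ₘ Form.imp ψ χ ::ₘ Γ) δ →
      G4CK (Form.imp (Form.or φ ψ) χ ::ₘ Γ) δ
  | pImpL (Γ n φ δ) :
      G4CK (Form.var n ::ₘ φ ::ₘ Γ) δ →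
      G4CK (Form.var n ::ₘ Form.imp (Form.var n) φ ::ₘ Γ) δ
  | impImpL (Γ φ ψ χ δ) :
      G4CK (Form.imp ψ χ ::ₘ Γ) (Form.imp φ ψ) → G4CK (χ ::ₘ Γ) δ →
      G4CK (Form.imp (Form.imp φ ψ) χ ::ₘ Γ) δ
  | boxR (Γ φ) : G4CK (boxInv Γ) φ → G4CK Γ (Form.box φ)
  | boxImpL (Γ φ ψ δ) :
      G4CK (boxInv Γ) φ → G4CK (ψ ::ₘ Γ) δ →
      G4CK (Form.imp (Form.box φ) ψ ::ₘ Γ) δ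
  | diaImpL (Γ γ φ ψ δ) :
      G4CK (γ ::ₘ boxInv Γ) φ → G4CK (ψ ::ₘ Form.dia γ ::ₘ Γ) δ →
      G4CK (Form.imp (Form.dia φ) ψ ::ₘ Form.dia γ ::ₘ Γ) δ
  | diaL (Γ φ ψ) : G4CK (φ ::ₘ boxInv Γ) ψ → G4CK (Form.dia φ ::ₘ Γ) (Form.dia ψ)

/-- Provability in the sequent calculus G4WK: sequents Γ ⇒ Δ with a
multiset antecedent and a succedent with at most one formula (`Option Form`). -/
inductive G4WK : Multiset Form → Option Form → Prop
  | botL (Γ Δ) : G4WK (Form.bot ::ₘ Γ) Δ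
  | idP (Γ n) : G4WK (Form.var n ::ₘ Γ) (some (Form.var n))
  | andL (Γ φ ψ Δ) : G4WK (φ ::ₘ ψ ::ₘ Γ) Δ → G4WK (Form.and φ ψ ::ₘ Γ) Δ
  | andR (Γ φ ψ) : G4WK Γ (some φ) → G4WK Γ (some ψ) → G4WK Γ (some (Form.and φ ψ))
  | orL (Γ φ ψ Δ) : G4WK (φ ::ₘ Γ) Δ → G4WK (ψ ::ₘ Γ) Δ → G4WK (Form.or φ ψ ::ₘ Γ) Δ
  | orR1 (Γ φ ψ) : G4WK Γ (some φ) → G4WK Γ (some (Form.or φ ψ))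
  | orR2 (Γ φ ψ) : G4WK Γ (some ψ) → G4WK Γ (some (Form.or φ ψ))
  | impR (Γ φ ψ) : G4WK (φ ::ₘ Γ) (some ψ) → G4WK Γ (some (Form.imp φ ψ))
  | andImpL (Γ φ ψ χ Δ) :
      G4WK (Form.imp φ (Form.imp ψ χ) ::ₘ Γ) Δ →
      G4WK (Form.imp (Form.and φ ψ) χ ::ₘ Γ) Δ
  | orImpL (Γ φ ψ χ Δ) :
      G4WK (Form.imp φ χ ::ₘ Form.imp ψ χ ::ₘ Γ) Δ →
      G4WK (Form.imp (Form.or φ ψ) χ ::ₘ Γ) Δ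
  | pImpL (Γ n φ Δ) :
      G4WK (Form.var n ::ₘ φ ::ₘ Γ) Δ →
      G4WK (Form.var n ::ₘ Form.imp (Form.var n) φ ::ₘ Γ) Δ
  | impImpL (Γ φ ψ χ Δ) :
      G4WK (Form.imp ψ χ ::ₘ Γ) (some (Form.imp φ ψ)) → G4WK (χ ::ₘ Γ) Δ →
      G4WK (Form.imp (Form.imp φ ψ) χ ::ₘ Γ) Δ
  | boxR (Γ φ) : G4WK (boxInv Γ) (some φ) → G4WK Γ (some (Form.box φ))
  | boxImpL (Γ φ ψ Δ) :
      G4WK (boxInv Γ) (some φ) → G4WK (ψ ::ₘ Γ) Δ →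
      G4WK (Form.imp (Form.box φ) ψ ::ₘ Γ) Δ
  | diaImpL (Γ γ φ ψ Δ) :
      G4WK (γ ::ₘ boxInv Γ) (some φ) → G4WK (ψ ::ₘ Form.dia γ ::ₘ Γ) Δ →
      G4WK (Form.imp (Form.dia φ) ψ ::ₘ Form.dia γ ::ₘ Γ) Δ
  | diaL' (Γ φ Δ) : G4WK (φ ::ₘ boxInv Γ) (diaInv Δ) → G4WK (Form.dia φ ::ₘ Γ) Δ

/-- Axiom schemes of the generalised Hilbert calculus CKH:
intuitionistic axioms A1–A9 together with K_□ and K_◇. -/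
inductive CKAx : Form → Prop
  | a1 (φ ψ : Form) : CKAx (φ.imp (ψ.imp φ))
  | a2 (φ ψ χ : Form) : CKAx ((φ.imp (ψ.imp χ)).imp ((φ.imp ψ).imp (φ.imp χ)))
  | a3 (φ ψ : Form) : CKAx (φ.imp (φ.or ψ))
  | a4 (φ ψ : Form) : CKAx (ψ.imp (φ.or ψ))
  | a5 (φ ψ χ : Form) : CKAx ((φ.imp χ).imp ((ψ.imp χ).imp ((φ.or ψ).imp χ)))
  | a6 (φ ψ : Form) : CKAx ((φ.and ψ).imp φ)
  | a7 (φ ψ : Form) : CKAx ((φ.and ψ).imp ψ)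
  | a8 (φ ψ χ : Form) : CKAx ((φ.imp ψ).imp ((φ.imp χ).imp (φ.imp (ψ.and χ))))
  | a9 (φ : Form) : CKAx (Form.bot.imp φ)
  | kbox (φ ψ : Form) : CKAx ((φ.imp ψ).box.imp (φ.box.imp ψ.box))
  | kdia (φ ψ : Form) : CKAx ((φ.imp ψ).box.imp (φ.dia.imp ψ.dia))

/-- Axiom schemes of WKH: those of CKH together with N : ¬◇⊥. -/
inductive WKAx : Form → Prop
  | ck {φ : Form} : CKAx φ → WKAx φ
  | n : WKAx (Form.bot.dia.imp Form.bot)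

/-- Derivability Γ ⊢ φ in the generalised Hilbert calculus CKH. -/
inductive CKH : Set Form → Form → Prop
  | ax {Γ : Set Form} {φ : Form} : CKAx φ → CKH Γ φ
  | el {Γ : Set Form} {φ : Form} : φ ∈ Γ → CKH Γ φ
  | mp {Γ : Set Form} {φ ψ : Form} : CKH Γ φ → CKH Γ (φ.imp ψ) → CKH Γ ψ
  | nec {Γ : Set Form} {φ : Form} : CKH ∅ φ → CKH Γ φ.box

/-- Derivability Γ ⊢ φ in the generalised Hilbert calculus WKH. -/
inductive WKH : Set Form → Form → Prop
  | ax {Γ : Set Form} {φ : Form} : WKAx φ → WKH Γ φ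
  | el {Γ : Set Form} {φ : Form} : φ ∈ Γ → WKH Γ φ
  | mp {Γ : Set Form} {φ ψ : Form} : WKH Γ φ → WKH Γ (φ.imp ψ) → WKH Γ ψ
  | nec {Γ : Set Form} {φ : Form} : WKH ∅ φ → WKH Γ φ.box

/-- The set of propositional variables occurring in a formula. -/
def vars : Form → Set ℕ
  | .var n => {n}
  | .bot => ∅
  | .and φ ψ => vars φ ∪ vars ψ
  | .or φ ψ => vars φ ∪ vars ψ
  | .imp φ ψ => vars φ ∪ vars ψ
  | .box φ => vars φ
  | .dia φ => vars φ

/-- Variables occurring in a multiset of formulas. -/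
def varsM (Γ : Multiset Form) : Set ℕ := {n | ∃ φ ∈ Γ, n ∈ vars φ}

/-- Variables occurring in a succedent with at most one formula. -/
def varsO : Option Form → Set ℕ
  | none => ∅
  | some φ => vars φ

/-- Birelational Kripke models for CK, with fallible worlds. -/
structure CKModel where
  W : Type
  le : W → W → Prop
  R : W → W → Prop
  V : W → ℕ → Prop
  F : W → Prop
  le_refl : ∀ x, le x x
  le_trans : ∀ {x y z}, le x y → le y z → le x z
  V_mono : ∀ {x y n}, le x y → V x n → V y n
  F_mono : ∀ {x y}, le x y → F x → F y
  F_V : ∀ {x n}, F x → V x n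
  F_R : ∀ {x y}, R x y → F x → F y
  F_serial : ∀ {x}, F x → ∃ y, R x y

namespace CKModel

/-- The forcing relation of a model. -/
def Force (M : CKModel) : Form → M.W → Prop
  | .var n, x => M.V x n
  | .bot, x => M.F x
  | .and φ ψ, x => M.Force φ x ∧ M.Force ψ x
  | .or φ ψ, x => M.Force φ x ∨ M.Force ψ x
  | .imp φ ψ, x => ∀ y, M.le x y → M.Force φ y → M.Force ψ y
  | .box φ, x => ∀ y, M.le x y → ∀ z, M.R y z → M.Force φ z
  | .dia φ, x => ∀ y, M.le x y → ∃ z, M.R y z ∧ M.Force φ z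

/-- A world forces every formula of a context. -/
def ForceAll (M : CKModel) (Γ : Multiset Form) (x : M.W) : Prop :=
  ∀ φ ∈ Γ, M.Force φ x

variable {M : CKModel}

@[simp] theorem forceAll_cons {φ : Form} {Γ : Multiset Form} {x : M.W} :
    M.ForceAll (φ ::ₘ Γ) x ↔ M.Force φ x ∧ M.ForceAll Γ x := by
  simp [ForceAll]

theorem Force.mono {φ : Form} {x y : M.W} (hxy : M.le x y) (h : M.Force φ x) :
    M.Force φ y := by
  induction φ with
  | var n => exact M.V_mono hxy h
  | bot => exact M.F_mono hxy h
  | and φ ψ ihφ ihψ => exact ⟨ihφ h.1, ihψ h.2⟩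
  | or φ ψ ihφ ihψ => exact h.imp ihφ ihψ
  | imp φ ψ => exact fun z hz => h z (M.le_trans hxy hz)
  | box φ => exact fun z hz => h z (M.le_trans hxy hz)
  | dia φ => exact fun z hz => h z (M.le_trans hxy hz)

theorem ForceAll.mono {Γ : Multiset Form} {x y : M.W} (hxy : M.le x y)
    (h : M.ForceAll Γ x) : M.ForceAll Γ y :=
  fun φ hφ => (h φ hφ).mono hxy

theorem force_of_fallible {φ : Form} {x : M.W} (h : M.F x) : M.Force φ x := by
  induction φ generalizing x with
  | var n => exact M.F_V h
  | bot => exact h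
  | and φ ψ ihφ ihψ => exact ⟨ihφ h, ihψ h⟩
  | or φ ψ ihφ _ => exact Or.inl (ihφ h)
  | imp φ ψ _ ihψ => exact fun y hy _ => ihψ (M.F_mono hy h)
  | box φ ih => exact fun y hy z hz => ih (M.F_R hz (M.F_mono hy h))
  | dia φ ih =>
    intro y hy
    obtain ⟨z, hz⟩ := M.F_serial (M.F_mono hy h)
    exact ⟨z, hz, ih (M.F_R hz (M.F_mono hy h))⟩

theorem force_imp_of_force {φ ψ : Form} {x : M.W} (h : M.Force ψ x) :
    M.Force (φ.imp ψ) x :=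
  fun _ hy _ => h.mono hy

end CKModel

theorem mem_boxInv {φ : Form} {Γ : Multiset Form} : φ ∈ boxInv Γ ↔ φ.box ∈ Γ := by
  rw [boxInv, Multiset.mem_filterMap]
  constructor
  · rintro ⟨ψ, hψ, h⟩
    cases ψ <;> simp_all [unboxF]
  · exact fun h => ⟨_, h, rfl⟩

namespace CKModel

variable {M : CKModel}

theorem forceAll_boxInv {Γ : Multiset Form} {x y z : M.W} (h : M.ForceAll Γ x)
    (hxy : M.le x y) (hyz : M.R y z) : M.ForceAll (boxInv Γ) z :=
  fun _ hφ => h _ (mem_boxInv.1 hφ) y hxy z hyz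

end CKModel

theorem G4CK.sound {Γ : Multiset Form} {δ : Form} (h : G4CK Γ δ) (M : CKModel) (x : M.W)
    (hx : M.ForceAll Γ x) : M.Force δ x := by
  induction h generalizing x with
  | botL Γ δ => exact CKModel.force_of_fallible (CKModel.forceAll_cons.1 hx).1
  | idP Γ n => exact (CKModel.forceAll_cons.1 hx).1
  | andL Γ φ ψ δ _ ih =>
    obtain ⟨⟨h₁, h₂⟩, hΓ⟩ := CKModel.forceAll_cons.1 hx
    exact ih x (by simp [*])
  | andR Γ φ ψ _ _ ih₁ ih₂ => exact ⟨ih₁ x hx, ih₂ x hx⟩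
  | orL Γ φ ψ δ _ _ ih₁ ih₂ =>
    obtain ⟨h | h, hΓ⟩ := CKModel.forceAll_cons.1 hx
    · exact ih₁ x (by simp [*])
    · exact ih₂ x (by simp [*])
  | orR1 Γ φ ψ _ ih => exact Or.inl (ih x hx)
  | orR2 Γ φ ψ _ ih => exact Or.inr (ih x hx)
  | impR Γ φ ψ _ ih =>
    exact fun y hxy hy => ih y (CKModel.forceAll_cons.2 ⟨hy, hx.mono hxy⟩)
  | andImpL Γ φ ψ χ δ _ ih =>
    obtain ⟨h, hΓ⟩ := CKModel.forceAll_cons.1 hx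
    refine ih x (CKModel.forceAll_cons.2 ⟨fun y hy hφ z hz hψ => ?_, hΓ⟩)
    exact h z (M.le_trans hy hz) ⟨hφ.mono hz, hψ⟩
  | orImpL Γ φ ψ χ δ _ ih =>
    obtain ⟨h, hΓ⟩ := CKModel.forceAll_cons.1 hx
    exact ih x (CKModel.forceAll_cons.2 ⟨fun y hy hφ => h y hy (Or.inl hφ),
      CKModel.forceAll_cons.2 ⟨fun y hy hψ => h y hy (Or.inr hψ), hΓ⟩⟩)
  | pImpL Γ n φ δ _ ih =>
    simp only [CKModel.forceAll_cons] at hx ih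
    exact ih x ⟨hx.1, hx.2.1 x (M.le_refl x) hx.1, hx.2.2⟩
  | impImpL Γ φ ψ χ δ _ _ ih₁ ih₂ =>
    simp only [CKModel.forceAll_cons] at hx ih₁ ih₂
    obtain ⟨h, hΓ⟩ := hx
    refine ih₂ x ⟨h x (M.le_refl x) (ih₁ x ⟨fun y hy hψ => ?_, hΓ⟩), hΓ⟩
    exact h y hy (CKModel.force_imp_of_force hψ)
  | boxR Γ φ _ ih => exact fun y hxy z hyz => ih z (CKModel.forceAll_boxInv hx hxy hyz)
  | boxImpL Γ φ ψ δ _ _ ih₁ ih₂ =>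
    simp only [CKModel.forceAll_cons] at hx ih₂
    obtain ⟨h, hΓ⟩ := hx
    exact ih₂ x ⟨h x (M.le_refl x)
      fun y hxy z hyz => ih₁ z (CKModel.forceAll_boxInv hΓ hxy hyz), hΓ⟩
  | diaImpL Γ γ φ ψ δ _ _ ih₁ ih₂ =>
    simp only [CKModel.forceAll_cons] at hx ih₁ ih₂
    obtain ⟨h, hγ, hΓ⟩ := hx
    refine ih₂ x ⟨h x (M.le_refl x) fun y hxy => ?_, hγ, hΓ⟩
    obtain ⟨z, hyz, hz⟩ := hγ y hxy
    exact ⟨z, hyz, ih₁ z ⟨hz, CKModel.forceAll_boxInv hΓ hxy hyz⟩⟩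
  | diaL Γ φ ψ _ ih =>
    simp only [CKModel.forceAll_cons] at hx ih
    obtain ⟨h, hΓ⟩ := hx
    intro y hxy
    obtain ⟨z, hyz, hz⟩ := h y hxy
    exact ⟨z, hyz, ih z ⟨hz, CKModel.forceAll_boxInv hΓ hxy hyz⟩⟩

namespace CKModel

/-- For each `◇γ ∈ Γ` some world refutes the sequent `□⁻¹Γ, γ ⇒ φ`. -/
def RefutesDia (M : CKModel) (Γ : Multiset Form) (φ : Form) : Prop :=
  ∀ γ, γ.dia ∈ Γ → ∃ w, M.Force γ w ∧ M.ForceAll (boxInv Γ) w ∧ ¬ M.Force φ w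

/-- Add to a model, for each context `Γ`, a cluster of worlds below all worlds forcing `Γ`.
The world of the cluster tagged by `φ` serves to refute `◇φ`, the untagged one to refute
boxed formulas. -/
def extend (M : CKModel) : CKModel where
  W := M.W ⊕ (Multiset Form × Option Form)
  le
    | .inl w, .inl w' => M.le w w'
    | .inl _, .inr _ => False
    | .inr c, .inl w => M.ForceAll c.1 w
    | .inr c, .inr c' => c.1 = c'.1
  R
    | .inl w, .inl w' => M.R w w'
    | .inr c, .inl w => M.ForceAll (boxInv c.1) w ∧
        ∀ φ, c.2 = some φ → M.RefutesDia c.1 φ → ¬ M.Force φ w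
    | _, .inr _ => False
  V
    | .inl w, n => M.V w n
    | .inr c, n => Form.var n ∈ c.1
  F
    | .inl w => M.F w
    | .inr _ => False
  le_refl := by
    rintro (w | c)
    · exact M.le_refl w
    · rfl
  le_trans := by
    rintro (w | c) (w' | c') (w'' | c'') h h' <;> simp only at h h' ⊢
    · exact M.le_trans h h'
    · exact ForceAll.mono h' h
    · rwa [h]
    · exact h.trans h'
  V_mono := by
    rintro (w | c) (w' | c') n h h' <;> simp only at h h' ⊢
    · exact M.V_mono h h'
    · exact h _ h'
    · rwa [← h]
  F_mono := by
    rintro (w | c) (w' | c') h h' <;> simp only at h h' ⊢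
    exact M.F_mono h h'
  F_V := by
    rintro (w | c) n h
    · exact M.F_V h
    · exact h.elim
  F_R := by
    rintro (w | c) (w' | c') h h' <;> simp only at h h' ⊢
    exact M.F_R h h'
  F_serial := by
    rintro (w | c) h
    · obtain ⟨y, hy⟩ := M.F_serial h
      exact ⟨.inl y, hy⟩
    · exact h.elim

variable {M : CKModel}

@[simp] theorem extend_force_inl {φ : Form} {w : M.W} :
    M.extend.Force φ (.inl w) ↔ M.Force φ w := by
  induction φ generalizing w with
  | var n => rfl
  | bot => rfl
  | and φ ψ ihφ ihψ => exact and_congr ihφ ihψ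
  | or φ ψ ihφ ihψ => exact or_congr ihφ ihψ
  | imp φ ψ ihφ ihψ =>
    constructor
    · exact fun h y hy hφ => ihψ.1 (h (.inl y) hy (ihφ.2 hφ))
    · rintro h (y | c) hy hφ
      · exact ihψ.2 (h y hy (ihφ.1 hφ))
      · exact hy.elim
  | box φ ih =>
    constructor
    · exact fun h y hy z hz => ih.1 (h (.inl y) hy (.inl z) hz)
    · rintro h (y | c) hy (z | c') hz
      · exact ih.2 (h y hy z hz)
      · exact hz.elim
      · exact hy.elim
      · exact hy.elim
  | dia φ ih =>
    constructor
    · intro h y hy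
      obtain ⟨z | c, hz, hφ⟩ := h (.inl y) hy
      · exact ⟨z, hz, ih.1 hφ⟩
      · exact hz.elim
    · rintro h (y | c) hy
      · obtain ⟨z, hz, hφ⟩ := h y hy
        exact ⟨.inl z, hz, ih.2 hφ⟩
      · exact hy.elim

theorem not_extend_force_of_forceAll {Γ : Multiset Form} {φ : Form} {t : Option Form} {w : M.W}
    (hw : M.ForceAll Γ w) (hφ : ¬ M.Force φ w) : ¬ M.extend.Force φ (.inr (Γ, t)) :=
  fun h => hφ (extend_force_inl.1
    (Force.mono (M := M.extend) (x := Sum.inr (Γ, t)) (y := Sum.inl w) hw h))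

theorem not_extend_force_box {Γ : Multiset Form} {φ : Form} {t : Option Form} {w : M.W}
    (hw : M.ForceAll (boxInv Γ) w) (hφ : ¬ M.Force φ w) :
    ¬ M.extend.Force φ.box (.inr (Γ, t)) :=
  fun h => hφ (extend_force_inl.1
    (h (.inr (Γ, none)) rfl (.inl w) ⟨hw, fun _ h => nomatch h⟩))

theorem not_extend_force_dia {Γ : Multiset Form} {φ : Form} {t : Option Form}
    (hφ : M.RefutesDia Γ φ) : ¬ M.extend.Force φ.dia (.inr (Γ, t)) := by
  intro h
  obtain ⟨z | c, hz, hz'⟩ := h (.inr (Γ, some φ)) rfl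
  · exact hz.2 φ rfl hφ (extend_force_inl.1 hz')
  · exact hz.elim

theorem extend_force_box {Γ : Multiset Form} {φ : Form} {t : Option Form}
    (hφ : φ.box ∈ Γ) : M.extend.Force φ.box (.inr (Γ, t)) := by
  rintro (w | ⟨Γ', t'⟩) hy (z | c) hz
  · exact extend_force_inl.2 (hy _ hφ w (M.le_refl w) z hz)
  · exact hz.elim
  · obtain rfl : Γ = Γ' := hy
    exact extend_force_inl.2 (hz.1 _ (mem_boxInv.2 hφ))
  · exact hz.elim

theorem extend_force_dia {Γ : Multiset Form} {φ : Form} {t : Option Form}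
    (hF : ∃ f, M.F f) (hφ : φ.dia ∈ Γ) : M.extend.Force φ.dia (.inr (Γ, t)) := by
  rintro (w | ⟨Γ', t'⟩) hy
  · obtain ⟨z, hz, h⟩ := hy _ hφ w (M.le_refl w)
    exact ⟨.inl z, hz, extend_force_inl.2 h⟩
  · obtain rfl : Γ = Γ' := hy
    by_cases ht : ∃ ψ, t' = some ψ ∧ M.RefutesDia Γ ψ
    · obtain ⟨ψ, rfl, hψ⟩ := ht
      obtain ⟨z, hz, hΓ, hz'⟩ := hψ _ hφ
      refine ⟨.inl z, ⟨hΓ, ?_⟩, extend_force_inl.2 hz⟩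
      rintro _ ⟨⟩ _
      exact hz'
    · obtain ⟨f, hf⟩ := hF
      exact ⟨.inl f, ⟨fun _ _ => force_of_fallible hf, fun ψ h h' => (ht ⟨ψ, h, h'⟩).elim⟩,
        extend_force_inl.2 (force_of_fallible hf)⟩

theorem extend_force_imp {Γ : Multiset Form} {φ ψ : Form} {t : Option Form}
    (h : φ.imp ψ ∈ Γ) (hφ : ∀ t', ¬ M.extend.Force φ (.inr (Γ, t'))) :
    M.extend.Force (φ.imp ψ) (.inr (Γ, t)) := by
  rintro (w | ⟨Γ', t'⟩) hy hy'
  · exact extend_force_inl.2 (hy _ h w (M.le_refl w) (extend_force_inl.1 hy'))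
  · obtain rfl : Γ = Γ' := hy
    exact (hφ t' hy').elim

end CKModel

namespace Form

/-- The weight of a formula, for which the principal formulas of the rules of `G4CK` are heavier
than the active ones. -/
def weight : Form → ℕ
  | .var _ => 1
  | .bot => 1
  | .and φ ψ => φ.weight + ψ.weight + 2
  | .or φ ψ => φ.weight + ψ.weight + 1
  | .imp φ ψ => φ.weight + ψ.weight + 1
  | .box φ => φ.weight + 1
  | .dia φ => φ.weight + 1

/-- The contribution of a formula to the size of a sequent. -/
def cost (φ : Form) : ℕ := 3 ^ φ.weight

theorem cost_pos (φ : Form) : 0 < φ.cost := Nat.pow_pos (by norm_num)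

theorem three_mul_cost_le {φ ψ : Form} (h : φ.weight < ψ.weight) : 3 * φ.cost ≤ ψ.cost := by
  rw [cost, cost, mul_comm, ← pow_succ]
  exact Nat.pow_le_pow_right (by norm_num) h

end Form

/-- The total cost of a context. -/
def contextCost (Γ : Multiset Form) : ℕ := (Γ.map Form.cost).sum

@[simp] theorem contextCost_cons (φ : Form) (Γ : Multiset Form) :
    contextCost (φ ::ₘ Γ) = φ.cost + contextCost Γ := by
  simp [contextCost]

theorem contextCost_boxInv_le (Γ : Multiset Form) : contextCost (boxInv Γ) ≤ contextCost Γ := by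
  induction Γ using Multiset.induction with
  | empty => simp [boxInv]
  | cons φ Γ ih =>
    cases φ with
    | box φ =>
      have h : boxInv (φ.box ::ₘ Γ) = φ ::ₘ boxInv Γ :=
        Multiset.filterMap_cons_some _ _ _ rfl
      have h' : 3 * φ.cost ≤ φ.box.cost := Form.three_mul_cost_le (by simp [Form.weight])
      rw [h, contextCost_cons, contextCost_cons]
      omega
    | _ =>
      rw [boxInv, Multiset.filterMap_cons_none _ _ rfl, contextCost_cons]
      exact ih.trans (Nat.le_add_left _ _)

theorem boxInv_cons_of_unboxF_eq_none {φ : Form} (Γ : Multiset Form) (h : unboxF φ = none) :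
    boxInv (φ ::ₘ Γ) = boxInv Γ :=
  Multiset.filterMap_cons_none _ _ h

namespace CKModel

variable {M : CKModel} {Γ : Multiset Form} {δ : Form}

/-- Every sequent cheaper than `Γ ⇒ δ` is provable or refuted in `M`. -/
def DecidesBelow (M : CKModel) (Γ : Multiset Form) (δ : Form) : Prop :=
  ∀ Γ' δ', contextCost Γ' + δ'.cost < contextCost Γ + δ.cost → ¬ G4CK Γ' δ' →
    ∃ w, M.ForceAll Γ' w ∧ ¬ M.Force δ' w

theorem DecidesBelow.provable (hM : M.DecidesBelow Γ δ) (hsat : ∀ w, M.ForceAll Γ w → M.Force δ w)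
    {Γ' : Multiset Form} (hc : contextCost Γ' < contextCost Γ)
    (h : ∀ w, M.ForceAll Γ' w → M.ForceAll Γ w) : G4CK Γ' δ := by
  by_contra hn
  obtain ⟨w, hw, hw'⟩ := hM Γ' δ (by omega) hn
  exact hw' (hsat w (h w hw))

theorem DecidesBelow.refutesDia (hM : M.DecidesBelow Γ δ) {φ : Form}
    (h : ∀ γ, γ.dia ∈ Γ → ¬ G4CK (γ ::ₘ boxInv Γ) φ)
    (hc : ∀ γ, γ.dia ∈ Γ →
      contextCost (γ ::ₘ boxInv Γ) + φ.cost < contextCost Γ + δ.cost) : M.RefutesDia Γ φ := by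
  intro γ hγ
  obtain ⟨w, hw, hw'⟩ := hM _ _ (hc γ hγ) (h γ hγ)
  exact ⟨w, (forceAll_cons.1 hw).1, (forceAll_cons.1 hw).2, hw'⟩

theorem not_extend_force_antecedent (hM : M.DecidesBelow Γ δ) (hn : ¬ G4CK Γ δ)
    (hsat : ∀ w, M.ForceAll Γ w → M.Force δ w) {φ ψ : Form} (h : φ.imp ψ ∈ Γ)
    (t : Option Form) : ¬ M.extend.Force φ (.inr (Γ, t)) := by
  obtain ⟨Γ', rfl⟩ := Multiset.exists_cons_of_mem h
  have hψ : G4CK (ψ ::ₘ Γ') δ := by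
    refine hM.provable hsat ?_ fun w hw => ?_
    · have h₁ : 3 * ψ.cost ≤ (φ.imp ψ).cost :=
        Form.three_mul_cost_le (by simp only [Form.weight]; omega)
      have h₂ := ψ.cost_pos
      simp only [contextCost_cons]
      omega
    · rw [forceAll_cons] at hw ⊢
      exact ⟨force_imp_of_force hw.1, hw.2⟩
  cases φ with
  | var n =>
    intro hv
    have hv : Form.var n ∈ (Form.var n).imp ψ ::ₘ Γ' := hv
    obtain ⟨Γ'', rfl⟩ := Multiset.exists_cons_of_mem
      ((Multiset.mem_cons.1 hv).resolve_left (by simp))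
    apply hn
    rw [Multiset.cons_swap]
    apply G4CK.pImpL
    rwa [Multiset.cons_swap]
  | bot => exact id
  | and a b =>
    refine (hn (.andImpL _ _ _ _ _ (hM.provable hsat ?_ fun w hw => ?_))).elim
    · have h₁ : 3 * (a.imp (b.imp ψ)).cost ≤ ((a.and b).imp ψ).cost :=
        Form.three_mul_cost_le (by simp only [Form.weight]; omega)
      have h₂ := (a.imp (b.imp ψ)).cost_pos
      simp only [contextCost_cons]
      omega
    · rw [forceAll_cons] at hw ⊢
      exact ⟨fun y hy h => hw.1 y hy h.1 y (M.le_refl y) h.2, hw.2⟩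
  | or a b =>
    refine (hn (.orImpL _ _ _ _ _ (hM.provable hsat ?_ fun w hw => ?_))).elim
    · have h₁ : 3 * (a.imp ψ).cost ≤ ((a.or b).imp ψ).cost :=
        Form.three_mul_cost_le (by simp only [Form.weight]; omega)
      have h₂ : 3 * (b.imp ψ).cost ≤ ((a.or b).imp ψ).cost :=
        Form.three_mul_cost_le (by simp only [Form.weight]; omega)
      have h₃ := (a.imp ψ).cost_pos
      simp only [contextCost_cons]
      omega
    · simp only [forceAll_cons] at hw ⊢
      exact ⟨fun y hy h => h.elim (hw.1 y hy) (hw.2.1 y hy), hw.2.2⟩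
  | imp a b =>
    obtain ⟨w, hw, hw'⟩ := hM (b.imp ψ ::ₘ Γ') (a.imp b) (by
      have h₁ : 3 * (b.imp ψ).cost ≤ ((a.imp b).imp ψ).cost :=
        Form.three_mul_cost_le (by simp only [Form.weight]; omega)
      have h₂ : 3 * (a.imp b).cost ≤ ((a.imp b).imp ψ).cost :=
        Form.three_mul_cost_le (by simp only [Form.weight]; omega)
      have h₃ := (a.imp b).cost_pos
      simp only [contextCost_cons]
      omega) fun h => hn (.impImpL _ _ _ _ _ h hψ)
    rw [forceAll_cons] at hw
    simp only [Force, not_forall] at hw'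
    obtain ⟨y, hy, ha, hb⟩ := hw'
    refine not_extend_force_of_forceAll (w := y) ?_ fun h => hb (h y (M.le_refl y) ha)
    rw [forceAll_cons]
    refine ⟨fun z hz hab => ?_, hw.2.mono hy⟩
    exact hw.1 z (M.le_trans hy hz) (hab z (M.le_refl z) (ha.mono hz))
  | box a =>
    obtain ⟨w, hw, hw'⟩ := hM (boxInv Γ') a (by
      have h₁ : 3 * a.cost ≤ (a.box.imp ψ).cost :=
        Form.three_mul_cost_le (by simp only [Form.weight]; omega)
      have h₂ := a.cost_pos
      have h₃ := contextCost_boxInv_le Γ'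
      simp only [contextCost_cons]
      omega) fun h => hn (.boxImpL _ _ _ _ h hψ)
    refine not_extend_force_box (w := w) ?_ hw'
    rwa [boxInv_cons_of_unboxF_eq_none _ rfl]
  | dia a =>
    refine not_extend_force_dia (hM.refutesDia (fun γ hγ hp => ?_) fun γ hγ => ?_) <;>
    obtain ⟨Γ'', rfl⟩ := Multiset.exists_cons_of_mem
      ((Multiset.mem_cons.1 hγ).resolve_left (by simp)) <;>
    rw [boxInv_cons_of_unboxF_eq_none _ rfl, boxInv_cons_of_unboxF_eq_none _ rfl] at *
    · exact hn (.diaImpL _ _ _ _ _ hp hψ)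
    · have h₁ : 3 * a.cost ≤ (a.dia.imp ψ).cost :=
        Form.three_mul_cost_le (by simp only [Form.weight]; omega)
      have h₂ : 3 * γ.cost ≤ γ.dia.cost := Form.three_mul_cost_le (by simp [Form.weight])
      have h₃ := a.cost_pos
      have h₄ := contextCost_boxInv_le Γ''
      simp only [contextCost_cons]
      omega

theorem extend_forceAll (hM : M.DecidesBelow Γ δ) (hF : ∃ f, M.F f) (hn : ¬ G4CK Γ δ)
    (hsat : ∀ w, M.ForceAll Γ w → M.Force δ w) (t : Option Form) :
    M.extend.ForceAll Γ (.inr (Γ, t)) := by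
  intro φ hφ
  cases φ with
  | var n => exact hφ
  | bot =>
    obtain ⟨Γ', rfl⟩ := Multiset.exists_cons_of_mem hφ
    exact (hn (.botL _ _)).elim
  | and a b =>
    obtain ⟨Γ', rfl⟩ := Multiset.exists_cons_of_mem hφ
    refine (hn (.andL _ _ _ _ (hM.provable hsat ?_ fun w hw => ?_))).elim
    · have h₁ : 3 * a.cost ≤ (a.and b).cost :=
        Form.three_mul_cost_le (by simp only [Form.weight]; omega)
      have h₂ : 3 * b.cost ≤ (a.and b).cost :=
        Form.three_mul_cost_le (by simp only [Form.weight]; omega)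
      have h₃ := a.cost_pos
      simp only [contextCost_cons]
      omega
    · simp only [forceAll_cons] at hw ⊢
      exact ⟨⟨hw.1, hw.2.1⟩, hw.2.2⟩
  | or a b =>
    obtain ⟨Γ', rfl⟩ := Multiset.exists_cons_of_mem hφ
    refine (hn (.orL _ _ _ _ (hM.provable hsat ?_ fun w hw => ?_)
      (hM.provable hsat ?_ fun w hw => ?_))).elim
    · have h₁ : 3 * a.cost ≤ (a.or b).cost :=
        Form.three_mul_cost_le (by simp only [Form.weight]; omega)
      have h₂ := a.cost_pos
      simp only [contextCost_cons]
      omega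
    · rw [forceAll_cons] at hw ⊢
      exact ⟨Or.inl hw.1, hw.2⟩
    · have h₁ : 3 * b.cost ≤ (a.or b).cost :=
        Form.three_mul_cost_le (by simp only [Form.weight]; omega)
      have h₂ := b.cost_pos
      simp only [contextCost_cons]
      omega
    · rw [forceAll_cons] at hw ⊢
      exact ⟨Or.inr hw.1, hw.2⟩
  | imp a b => exact extend_force_imp hφ (not_extend_force_antecedent hM hn hsat hφ)
  | box a => exact extend_force_box hφ
  | dia a => exact extend_force_dia hF hφ

theorem not_extend_force_succedent (hM : M.DecidesBelow Γ δ) (hn : ¬ G4CK Γ δ)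
    (hsat : ∀ w, M.ForceAll Γ w → M.Force δ w) (t : Option Form) :
    ¬ M.extend.Force δ (.inr (Γ, t)) := by
  have sub {φ : Form} (hw : φ.weight < δ.weight) (hφ : ¬ G4CK Γ φ) :
      ∃ w, M.ForceAll Γ w ∧ ¬ M.Force φ w := by
    refine hM _ _ ?_ hφ
    have h₁ := Form.three_mul_cost_le hw
    have h₂ := φ.cost_pos
    omega
  cases δ with
  | var n =>
    intro h
    obtain ⟨Γ', rfl⟩ := Multiset.exists_cons_of_mem (show Form.var n ∈ Γ from h)
    exact hn (.idP _ _)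
  | bot => exact id
  | and a b =>
    refine (hn (.andR _ _ _ ?_ ?_)).elim <;> by_contra hp
    · obtain ⟨w, hw, hw'⟩ := sub (by simp only [Form.weight]; omega) hp
      exact hw' (hsat w hw).1
    · obtain ⟨w, hw, hw'⟩ := sub (by simp only [Form.weight]; omega) hp
      exact hw' (hsat w hw).2
  | or a b =>
    obtain ⟨w, hw, hw'⟩ := sub (by simp only [Form.weight]; omega) fun h => hn (.orR1 _ a b h)
    obtain ⟨v, hv, hv'⟩ := sub (by simp only [Form.weight]; omega) fun h => hn (.orR2 _ a b h)
    rintro (h | h)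
    · exact not_extend_force_of_forceAll hw hw' h
    · exact not_extend_force_of_forceAll hv hv' h
  | imp a b =>
    obtain ⟨w, hw, hw'⟩ := hM (a ::ₘ Γ) b (by
      have h₁ : 3 * a.cost ≤ (a.imp b).cost :=
        Form.three_mul_cost_le (by simp only [Form.weight]; omega)
      have h₂ : 3 * b.cost ≤ (a.imp b).cost :=
        Form.three_mul_cost_le (by simp only [Form.weight]; omega)
      have h₃ := a.cost_pos
      simp only [contextCost_cons]
      omega) fun h => hn (.impR _ _ _ h)
    rw [forceAll_cons] at hw
    exact (hw' (hsat w hw.2 w (M.le_refl w) hw.1)).elim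
  | box a =>
    obtain ⟨w, hw, hw'⟩ := hM (boxInv Γ) a (by
      have h₁ : 3 * a.cost ≤ a.box.cost := Form.three_mul_cost_le (by simp [Form.weight])
      have h₂ := a.cost_pos
      have h₃ := contextCost_boxInv_le Γ
      omega) fun h => hn (.boxR _ _ h)
    exact not_extend_force_box hw hw'
  | dia a =>
    refine not_extend_force_dia (hM.refutesDia (fun γ hγ hp => ?_) fun γ hγ => ?_) <;>
    obtain ⟨Γ', rfl⟩ := Multiset.exists_cons_of_mem hγ <;>
    rw [boxInv_cons_of_unboxF_eq_none _ rfl] at *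
    · exact hn (.diaL _ _ _ hp)
    · have h₁ : 3 * a.cost ≤ a.dia.cost := Form.three_mul_cost_le (by simp [Form.weight])
      have h₂ : 3 * γ.cost ≤ γ.dia.cost := Form.three_mul_cost_le (by simp [Form.weight])
      have h₃ := a.cost_pos
      have h₄ := contextCost_boxInv_le Γ'
      simp only [contextCost_cons]
      omega

/-- The model with a single, fallible, world. -/
def fallible : CKModel where
  W := Unit
  le _ _ := True
  R _ _ := True
  V _ _ := True
  F _ := True
  le_refl _ := trivial
  le_trans _ _ := trivial
  V_mono _ _ := trivial
  F_mono _ _ := trivial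
  F_V _ := trivial
  F_R _ _ := trivial
  F_serial _ := ⟨(), trivial⟩

theorem exists_refuting (n : ℕ) : ∃ M : CKModel, (∃ f, M.F f) ∧
    ∀ Γ δ, contextCost Γ + δ.cost < n → ¬ G4CK Γ δ → ∃ w, M.ForceAll Γ w ∧ ¬ M.Force δ w := by
  induction n with
  | zero => exact ⟨fallible, ⟨(), trivial⟩, by simp⟩
  | succ n ih =>
    obtain ⟨M, ⟨f, hf⟩, hM⟩ := ih
    refine ⟨M.extend, ⟨.inl f, hf⟩, fun Γ δ hc hn => ?_⟩
    by_cases hsat : ∀ w, M.ForceAll Γ w → M.Force δ w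
    · have hd : M.DecidesBelow Γ δ := fun Γ' δ' hc' => hM Γ' δ' (by omega)
      exact ⟨.inr (Γ, none), extend_forceAll hd ⟨f, hf⟩ hn hsat none,
        not_extend_force_succedent hd hn hsat none⟩
    · push Not at hsat
      obtain ⟨w, hw, hw'⟩ := hsat
      exact ⟨.inl w, fun φ hφ => extend_force_inl.2 (hw φ hφ), mt extend_force_inl.1 hw'⟩

end CKModel

theorem G4CK.complete {Γ : Multiset Form} {δ : Form}
    (h : ∀ (M : CKModel) (x : M.W), M.ForceAll Γ x → M.Force δ x) : G4CK Γ δ := by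
  by_contra hn
  obtain ⟨M, -, hM⟩ := CKModel.exists_refuting (contextCost Γ + δ.cost + 1)
  obtain ⟨w, hw, hw'⟩ := hM Γ δ (Nat.lt_succ_self _) hn
  exact hw' (h M w hw)

/-- The additive cut rule is admissible in G4CK:
if Γ ⇒ φ and Γ,φ ⇒ δ are provable then so is Γ ⇒ δ. -/
theorem additive_cut_G4CK :
    ∀ (Γ : Multiset Form) (φ δ : Form),
      G4CK Γ φ → G4CK (φ ::ₘ Γ) δ → G4CK Γ δ := by
  intro Γ φ δ h₁ h₂
  exact G4CK.complete fun M x hx =>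
    h₂.sound M x (CKModel.forceAll_cons.2 ⟨h₁.sound M x hx, hx⟩)
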